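/- For every n ≥ 1, the complex matrix M₃ of the sector-changing duality symmetry U₂₁ satisfies M₃† · M₃ = (1/2)(I − F), where M₃† is the conjugate transpose, I is the identity matrix on the space indexed by periodic binary strings, and F is the permutation matrix of the componentwise flip on periodic binary strings. (This is the unitarity of U₂₁ on the physical, flip-antisymmetric subspace of the Ramond sector.) -/

import Mathlib

open Matrix

instance (n : ℕ) [NeZero n] : NeZero (2 * n) :=
  ⟨Nat.mul_ne_zero two_ne_zero (NeZero.ne n)⟩

/-- Antiperiodic binary strings on `ℤ/2n`: `ν : ℤ/2n → {0,1}` with `ν(i+n) = 1 − ν(i)`. -/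
abbrev APString (n : ℕ) [NeZero n] :=
  {ν : ZMod (2 * n) → Fin 2 // ∀ i, ν (i + (n : ZMod (2 * n))) = 1 - ν i}

/-- Periodic binary strings on `ℤ/2n`: `μ : ℤ/2n → {0,1}` with `μ(i+n) = μ(i)`. -/
abbrev PString (n : ℕ) [NeZero n] :=
  {μ : ZMod (2 * n) → Fin 2 // ∀ i, μ (i + (n : ZMod (2 * n))) = μ i}

/-- `par x = 0` if `x` is even and `par x = 1` if `x` is odd. -/
def par (x : ℤ) : ℤ := x % 2

/-- `T(μ,ν) = Σ_{i ∈ ℤ/2n} μ(i)·par(ν(i+1) − ν(i))` for a periodic binary string `μ`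
and an antiperiodic binary string `ν`. -/
def Tmat (n : ℕ) [NeZero n] (μ : PString n) (ν : APString n) : ℤ :=
  ∑ i : ZMod (2 * n),
    ((μ.1 i : ℕ) : ℤ) * par (((ν.1 (i + 1) : ℕ) : ℤ) - ((ν.1 i : ℕ) : ℤ))

/-- The complex matrix `M₃` of the sector-changing duality symmetry `U₂₁`, with entries
`M₃(ν,μ) = 2^{−(n+1)/2}·e^{−iπ/4}·i^{T(μ,ν)}`, rows indexed by antiperiodic and columns
by periodic binary strings on `ℤ/2n`. -/
noncomputable def M3 (n : ℕ) [NeZero n] : Matrix (APString n) (PString n) ℂ :=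
  fun ν μ => (((2 : ℝ) ^ (-(((n : ℝ) + 1) / 2)) : ℝ) : ℂ) *
    Complex.exp (-(Real.pi * Complex.I) / 4) * Complex.I ^ Tmat n μ ν

/-- The permutation matrix `F` of the componentwise flip `μ ↦ 1−μ` on periodic
binary strings. -/
def flipMat (n : ℕ) [NeZero n] : Matrix (PString n) (PString n) ℂ :=
  fun ρ μ => if ρ.1 = (fun i => 1 - μ.1 i) then 1 else 0

/-- Translation by `n` on `ℤ/2n` is an involution. -/
lemma ZMod.add_half_add_half (n : ℕ) (i : ZMod (2 * n)) :
    i + (n : ZMod (2 * n)) + (n : ZMod (2 * n)) = i := by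
  have h : ((2 * n : ℕ) : ZMod (2 * n)) = 0 := ZMod.natCast_self _
  push_cast at h
  linear_combination h

lemma ZMod.half_ne_zero (n : ℕ) [NeZero n] : (n : ZMod (2 * n)) ≠ 0 := by
  rw [Ne, ZMod.natCast_eq_zero_iff]
  intro h
  have := Nat.le_of_dvd (NeZero.pos n) h
  have := NeZero.pos n
  omega

lemma ZMod.sum_eq_sum_range (m : ℕ) [NeZero m] (f : ZMod m → ℤ) :
    ∑ i, f i = ∑ i ∈ Finset.range m, f (i : ZMod m) := by
  refine Finset.sum_bij' (fun i _ => i.val) (fun i _ => (i : ZMod m)) ?_ ?_ ?_ ?_ ?_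
  · intro i _
    simpa using i.val_lt
  · simp
  · simp
  · intro i hi
    exact ZMod.val_cast_of_lt (by simpa using hi)
  · simp

lemma ZMod.sum_eq_two_mul_sum_range (n : ℕ) [NeZero n] (f : ZMod (2 * n) → ℤ)
    (hf : ∀ i, f (i + (n : ZMod (2 * n))) = f i) :
    ∑ i, f i = 2 * ∑ i ∈ Finset.range n, f (i : ZMod (2 * n)) := by
  have h : ∀ i : ℕ, f ((n + i : ℕ) : ZMod (2 * n)) = f (i : ZMod (2 * n)) := fun i => by
    rw [Nat.cast_add, add_comm, hf]
  rw [ZMod.sum_eq_sum_range, Finset.sum_congr (congrArg Finset.range (two_mul n)) fun _ _ => rfl,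
    Finset.sum_range_add]
  simp only [h]
  ring

/-- The domain-wall indicator `par(ν(i+1) − ν(i))`. -/
def wall {m : ℕ} (ν : ZMod m → Fin 2) (i : ZMod m) : ℤ :=
  par (((ν (i + 1) : ℕ) : ℤ) - ((ν i : ℕ) : ℤ))

lemma par_one_sub_sub (a b : Fin 2) :
    par ((((1 - a : Fin 2) : ℕ) : ℤ) - ((b : ℕ) : ℤ)) =
      1 - par (((a : ℕ) : ℤ) - ((b : ℕ) : ℤ)) := by
  revert a b; decide

lemma par_sub_one_sub (a b : Fin 2) :
    par (((a : ℕ) : ℤ) - (((1 - b : Fin 2) : ℕ) : ℤ)) =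
      1 - par (((a : ℕ) : ℤ) - ((b : ℕ) : ℤ)) := by
  revert a b; decide

lemma coe_one_sub (a : Fin 2) : (((1 - a : Fin 2) : ℕ) : ℤ) = 1 - ((a : ℕ) : ℤ) := by
  revert a; decide

lemma eq_of_even_sub {a b : Fin 2} (h : Even (((a : ℕ) : ℤ) - ((b : ℕ) : ℤ))) : a = b := by
  revert a b; decide

lemma eq_one_sub_of_odd_sub {a b : Fin 2} (h : Odd (((a : ℕ) : ℤ) - ((b : ℕ) : ℤ))) :
    b = 1 - a := by
  revert a b; decide

section

variable {n : ℕ} [NeZero n]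

lemma wall_add_half (ν : APString n) (i : ZMod (2 * n)) :
    wall ν.1 (i + (n : ZMod (2 * n))) = wall ν.1 i := by
  rw [wall, add_right_comm, ν.2, ν.2, par_one_sub_sub, par_sub_one_sub, wall]
  ring

lemma odd_sum_wall (ν : APString n) :
    Odd (∑ i ∈ Finset.range n, wall ν.1 (i : ZMod (2 * n))) := by
  have key : ∀ m : ℕ, Even (∑ i ∈ Finset.range m, wall ν.1 (i : ZMod (2 * n)) -
      (((ν.1 (m : ZMod (2 * n)) : ℕ) : ℤ) - ((ν.1 0 : ℕ) : ℤ))) := by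
    intro m
    induction m with
    | zero => simp
    | succ m ih =>
      rw [Finset.sum_range_succ, wall, par, Nat.cast_succ]
      rw [Int.even_iff] at ih ⊢
      omega
  have h := key n
  have h0 := ν.2 0
  rw [zero_add] at h0
  rw [h0, coe_one_sub, Int.even_iff] at h
  rw [Int.odd_iff]
  omega

lemma Tmat_eq (μ : PString n) (ν : APString n) :
    Tmat n μ ν = ∑ i, ((μ.1 i : ℕ) : ℤ) * wall ν.1 i := rfl

lemma even_Tmat (μ : PString n) (ν : APString n) : Even (Tmat n μ ν) := by
  rw [Tmat_eq, ZMod.sum_eq_two_mul_sum_range]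
  · exact even_two_mul _
  · intro i
    rw [wall_add_half, μ.2]

/-- Flipping an antiperiodic string at `k` and `k + n`. -/
def APString.flipAt (k : ZMod (2 * n)) (ν : APString n) : APString n :=
  ⟨fun i => if i = k ∨ i = k + (n : ZMod (2 * n)) then 1 - ν.1 i else ν.1 i, by
    intro i
    have h : i + (n : ZMod (2 * n)) = k ∨ i + (n : ZMod (2 * n)) = k + (n : ZMod (2 * n)) ↔
        i = k ∨ i = k + (n : ZMod (2 * n)) := by
      rw [add_left_inj, or_comm]
      refine or_congr_right ⟨?_, ?_⟩
      · rintro rfl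
        rw [ZMod.add_half_add_half]
      · rintro rfl
        rw [ZMod.add_half_add_half]
    simp only [h, ν.2]
    split_ifs <;> rfl⟩

lemma APString.flipAt_flipAt (k : ZMod (2 * n)) (ν : APString n) :
    (ν.flipAt k).flipAt k = ν := by
  ext1
  funext i
  simp only [APString.flipAt]
  split_ifs
  · exact sub_sub_cancel _ _
  · rfl

lemma wall_flipAt (k : ZMod (2 * n)) (ν : APString n) (h0 : (1 : ZMod (2 * n)) ≠ 0)
    (h1 : (1 : ZMod (2 * n)) ≠ n) (i : ZMod (2 * n)) :
    wall (ν.flipAt (k + 1)).1 i - wall ν.1 i =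
      (if i = k then 1 - 2 * wall ν.1 i else 0) +
      (if i = k + (n : ZMod (2 * n)) then 1 - 2 * wall ν.1 i else 0) +
      (if i = k + 1 then 1 - 2 * wall ν.1 i else 0) +
      (if i = k + 1 + (n : ZMod (2 * n)) then 1 - 2 * wall ν.1 i else 0) := by
  have hn := ZMod.half_ne_zero n
  have hnn := ZMod.add_half_add_half n 0
  have e1 : i + 1 = k + 1 ↔ i = k := add_left_inj 1
  have e2 : i + 1 = k + 1 + (n : ZMod (2 * n)) ↔ i = k + (n : ZMod (2 * n)) := by
    rw [add_right_comm, add_left_inj]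
  simp only [wall, APString.flipAt, e1, e2]
  by_cases c1 : i = k
  · subst c1
    have : i ≠ i + 1 + (n : ZMod (2 * n)) := fun h => h1 (by linear_combination -h - hnn)
    simp [hn, h0, this, par_one_sub_sub]
    ring
  by_cases c2 : i = k + (n : ZMod (2 * n))
  · subst c2
    have a1 : k + (n : ZMod (2 * n)) ≠ k + 1 := fun h => h1 (by linear_combination -h)
    have a2 : k + (n : ZMod (2 * n)) ≠ k + 1 + (n : ZMod (2 * n)) :=
      fun h => h0 (by linear_combination -h)
    simp [c1, a1, a2, par_one_sub_sub]
    ring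
  by_cases c3 : i = k + 1
  · subst c3
    simp [hn, c2, h0, par_sub_one_sub]
    ring
  by_cases c4 : i = k + 1 + (n : ZMod (2 * n))
  · subst c4
    simp [c1, c2, c3, par_sub_one_sub]
    ring
  · simp [c1, c2, c3, c4]

lemma sum_mul_wall_flipAt (e : ZMod (2 * n) → ℤ)
    (he : ∀ i, e (i + (n : ZMod (2 * n))) = e i) (k : ZMod (2 * n))
    (hk : Odd (e k + e (k + 1))) (ν : APString n) :
    ∃ c : ℤ, ∑ i, e i * wall (ν.flipAt (k + 1)).1 i =
      ∑ i, e i * wall ν.1 i + (4 * c + 2) := by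
  have hne : e k ≠ e (k + 1) := fun h => by
    rw [h] at hk
    exact Int.not_even_iff_odd.2 hk (Even.add_self _)
  have h0 : (1 : ZMod (2 * n)) ≠ 0 := fun h => hne (by rw [h, add_zero])
  have h1 : (1 : ZMod (2 * n)) ≠ n := fun h => hne (by rw [h, he])
  have hsum : ∑ i, e i * wall (ν.flipAt (k + 1)).1 i - ∑ i, e i * wall ν.1 i =
      2 * (e k * (1 - 2 * wall ν.1 k) + e (k + 1) * (1 - 2 * wall ν.1 (k + 1))) := by
    rw [← Finset.sum_sub_distrib]
    simp only [← mul_sub, wall_flipAt k ν h0 h1]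
    simp only [mul_add, Finset.sum_add_distrib, mul_ite, mul_zero, Finset.sum_ite_eq',
      Finset.mem_univ, if_true, he, wall_add_half]
    ring
  obtain ⟨m, hm⟩ := hk
  refine ⟨m - e k * wall ν.1 k - e (k + 1) * wall ν.1 (k + 1), ?_⟩
  linear_combination hsum + 2 * hm

lemma I_zpow_four_mul_add_two (c : ℤ) : Complex.I ^ (4 * c + 2) = -1 := by
  rw [zpow_add₀ Complex.I_ne_zero, _root_.zpow_mul]
  norm_cast
  simp [Complex.I_pow_four]

lemma sum_I_zpow_eq_zero (e : ZMod (2 * n) → ℤ)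
    (he : ∀ i, e (i + (n : ZMod (2 * n))) = e i) (k : ZMod (2 * n))
    (hk : Odd (e k + e (k + 1))) :
    ∑ ν : APString n, Complex.I ^ (∑ i, e i * wall ν.1 i) = 0 := by
  have hcancel : ∀ ν : APString n, Complex.I ^ (∑ i, e i * wall ν.1 i) +
      Complex.I ^ (∑ i, e i * wall (ν.flipAt (k + 1)).1 i) = 0 := by
    intro ν
    obtain ⟨c, hc⟩ := sum_mul_wall_flipAt e he k hk ν
    rw [hc, zpow_add₀ Complex.I_ne_zero, I_zpow_four_mul_add_two]
    ring
  refine Finset.sum_involution (fun ν _ => ν.flipAt (k + 1)) (fun ν _ => hcancel ν) ?_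
    (fun _ _ => Finset.mem_univ _) (fun ν _ => ν.flipAt_flipAt (k + 1))
  intro ν _ hν h
  have := hcancel ν
  rw [h, ← two_mul] at this
  exact hν ((mul_eq_zero.1 this).resolve_left two_ne_zero)

/-- An antiperiodic string is determined by its values on `{0, …, n-1}`. -/
def APString.equivFun (n : ℕ) [NeZero n] : APString n ≃ (Fin n → Fin 2) where
  toFun ν j := ν.1 ((j : ℕ) : ZMod (2 * n))
  invFun f := ⟨fun i => if h : i.val < n then f ⟨i.val, h⟩ else
      1 - f ⟨i.val - n, by have := i.val_lt; omega⟩, by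
    intro i
    have hn := NeZero.pos n
    have hi := i.val_lt
    have hv : (i + (n : ZMod (2 * n))).val = (i.val + n) % (2 * n) := by
      rw [ZMod.val_add, ZMod.val_cast_of_lt (by omega)]
    by_cases h : i.val < n
    · rw [Nat.mod_eq_of_lt (by omega)] at hv
      simp [hv, h]
    · have hv' : (i + (n : ZMod (2 * n))).val = i.val - n := by
        rw [hv, Nat.mod_eq_sub_mod (by omega), Nat.mod_eq_of_lt (by omega)]
        omega
      have h' : i.val - n < n := by omega
      simp [hv', h, h']⟩
  left_inv ν := by
    ext1
    funext i
    by_cases h : i.val < n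
    · simp [h]
    · have h2 := ν.2 ((i.val - n : ℕ) : ZMod (2 * n))
      rw [← Nat.cast_add, Nat.sub_add_cancel (not_lt.1 h), ZMod.natCast_zmod_val] at h2
      simp only [h, dif_neg, not_false_eq_true]
      exact h2.symm
  right_inv f := by
    funext j
    have hj := j.2
    have hv : ((j : ℕ) : ZMod (2 * n)).val = j := ZMod.val_cast_of_lt (by omega)
    simp [hv]

lemma card_APString : Fintype.card (APString n) = 2 ^ n := by
  rw [Fintype.card_congr (APString.equivFun n)]
  simp

lemma even_or_odd_of_even_add_succ {m : ℕ} [NeZero m] (e : ZMod m → ℤ)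
    (h : ∀ k, Even (e k + e (k + 1))) : (∀ k, Even (e k)) ∨ ∀ k, Odd (e k) := by
  have key : ∀ j : ℕ, Even (e (j : ZMod m)) ↔ Even (e 0) := by
    intro j
    induction j with
    | zero => simp
    | succ j ih => rw [Nat.cast_succ, ← ih, ← Int.even_add.1 (h _)]
  have key' : ∀ k, Even (e k) ↔ Even (e 0) := fun k => by
    rw [← key k.val, ZMod.natCast_zmod_val]
  by_cases h0 : Even (e 0)
  · exact Or.inl fun k => (key' k).2 h0
  · exact Or.inr fun k => Int.not_even_iff_odd.1 fun hk => h0 ((key' k).1 hk)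

lemma I_zpow_sub_of_flip {ρ μ : PString n} (h : ρ.1 = fun i => 1 - μ.1 i) (ν : APString n) :
    Complex.I ^ (Tmat n μ ν - Tmat n ρ ν) = -1 := by
  have hsum : Tmat n μ ν + Tmat n ρ ν = ∑ i, wall ν.1 i := by
    rw [Tmat_eq, Tmat_eq, ← Finset.sum_add_distrib]
    refine Finset.sum_congr rfl fun i _ => ?_
    rw [h, coe_one_sub]
    ring
  rw [ZMod.sum_eq_two_mul_sum_range n _ (wall_add_half ν)] at hsum
  obtain ⟨a, ha⟩ := odd_sum_wall ν
  obtain ⟨b, hb⟩ := even_Tmat ρ ν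
  rw [show Tmat n μ ν - Tmat n ρ ν = 4 * (a - b) + 2 by
    linear_combination hsum + 2 * ha - 2 * hb, I_zpow_four_mul_add_two]

lemma flip_ne (μ : PString n) : μ.1 ≠ fun i => 1 - μ.1 i := by
  intro h
  have h0 := congrFun h 0
  revert h0
  generalize μ.1 0 = a
  revert a
  decide

lemma sum_I_zpow_Tmat_sub (ρ μ : PString n) :
    ∑ ν : APString n, Complex.I ^ (Tmat n μ ν - Tmat n ρ ν) =
      2 ^ n * ((1 : Matrix (PString n) (PString n) ℂ) - flipMat n) ρ μ := by
  rw [Matrix.sub_apply, flipMat]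
  by_cases h1 : ρ = μ
  · subst h1
    simp only [sub_self, zpow_zero, Finset.sum_const, Finset.card_univ, card_APString,
      Matrix.one_apply_eq, if_neg (flip_ne ρ)]
    simp
  by_cases h2 : ρ.1 = fun i => 1 - μ.1 i
  · simp only [I_zpow_sub_of_flip h2, Finset.sum_const, Finset.card_univ, card_APString,
      Matrix.one_apply_ne h1, if_pos h2]
    simp
  rw [Matrix.one_apply_ne h1, if_neg h2, sub_zero, mul_zero]
  have hT : ∀ ν : APString n, Tmat n μ ν - Tmat n ρ ν =
      ∑ i, (((μ.1 i : ℕ) : ℤ) - ((ρ.1 i : ℕ) : ℤ)) * wall ν.1 i := fun ν => by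
    simp only [Tmat_eq, sub_mul, Finset.sum_sub_distrib]
  simp only [hT]
  by_cases hk : ∀ k, Even ((((μ.1 k : ℕ) : ℤ) - ((ρ.1 k : ℕ) : ℤ)) +
      (((μ.1 (k + 1) : ℕ) : ℤ) - ((ρ.1 (k + 1) : ℕ) : ℤ)))
  · rcases even_or_odd_of_even_add_succ
      (fun k => ((μ.1 k : ℕ) : ℤ) - ((ρ.1 k : ℕ) : ℤ)) hk with h | h
    · exact absurd (Subtype.ext (funext fun k => (eq_of_even_sub (h k)).symm)) h1
    · exact absurd (funext fun k => eq_one_sub_of_odd_sub (h k)) h2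
  · obtain ⟨k, hk⟩ := not_forall.1 hk
    exact sum_I_zpow_eq_zero (fun k => ((μ.1 k : ℕ) : ℤ) - ((ρ.1 k : ℕ) : ℤ))
      (fun i => by simp only [μ.2, ρ.2]) k (Int.not_even_iff_odd.1 hk)

lemma star_M3_mul_M3 (ρ μ : PString n) (ν : APString n) :
    star (M3 n ν ρ) * M3 n ν μ =
      (2 ^ (n + 1))⁻¹ * Complex.I ^ (Tmat n μ ν - Tmat n ρ ν) := by
  have hphase : star (Complex.exp (-(Real.pi * Complex.I) / 4)) *
      Complex.exp (-(Real.pi * Complex.I) / 4) = 1 := by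
    rw [Complex.star_def, ← Complex.exp_conj, ← Complex.exp_add, ← Complex.exp_zero]
    congr 1
    simp [Complex.conj_ofNat]
    ring
  have hI : star (Complex.I ^ Tmat n ρ ν) = Complex.I ^ (-Tmat n ρ ν) := by
    rw [star_zpow₀, Complex.star_def, Complex.conj_I, ← Complex.inv_I, _root_.inv_zpow, _root_.zpow_neg]
  have hc : (((2 : ℝ) ^ (-(((n : ℝ) + 1) / 2)) : ℝ) : ℂ) *
      (((2 : ℝ) ^ (-(((n : ℝ) + 1) / 2)) : ℝ) : ℂ) = (2 ^ (n + 1))⁻¹ := by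
    rw [← Complex.ofReal_mul, ← Real.rpow_add two_pos,
      show -(((n : ℝ) + 1) / 2) + -(((n : ℝ) + 1) / 2) = -((n + 1 : ℕ) : ℝ) by push_cast; ring,
      Real.rpow_neg two_pos.le, Real.rpow_natCast]
    push_cast
    rfl
  have hr : star (((2 : ℝ) ^ (-(((n : ℝ) + 1) / 2)) : ℝ) : ℂ) =
      (((2 : ℝ) ^ (-(((n : ℝ) + 1) / 2)) : ℝ) : ℂ) := Complex.conj_ofReal _
  rw [M3, M3, star_mul', star_mul', hI, hr, sub_eq_neg_add, zpow_add₀ Complex.I_ne_zero, ← hc]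
  linear_combination (((2 : ℝ) ^ (-(((n : ℝ) + 1) / 2)) : ℝ) : ℂ) ^ 2 *
    Complex.I ^ (-Tmat n ρ ν) * Complex.I ^ Tmat n μ ν * hphase

end

/-- Unitarity of `U₂₁` on the physical, flip-antisymmetric subspace of the Ramond
sector: `M₃† · M₃ = (1/2)(I − F)`. -/
theorem M3_conjTranspose_mul_M3 (n : ℕ) [NeZero n] :
    (M3 n)ᴴ * M3 n = (1 / 2 : ℂ) • (1 - flipMat n) := by
  ext ρ μ
  simp only [Matrix.mul_apply, Matrix.conjTranspose_apply, star_M3_mul_M3, ← Finset.mul_sum,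
    sum_I_zpow_Tmat_sub, Matrix.smul_apply, smul_eq_mul]
  rw [← mul_assoc]
  congr 1
  field_simp
  ring
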